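/- Band-limited interpolation error: Let s > 1 and A ∈ C⁰([−τ₀,τ₀], H^s(ℝ²)). For ε ∈ (0,1], define the sampled sequence a_{m,n}(t) := A(ε(m−t), ε²n, ε³t) and the band-limited approximation ψ_u(t) on ℤ² as the inverse Fourier series of ψ̂_u(k,l,t) = ε^{-3} e^{ikt} χ_{𝕋²}(k,l) Â(ε^{-1}k, ε^{-2}l, ε³t). Then there exists a constant C_s > 0 such that for all ε ∈ (0,1] and all t ∈ [−ε^{-3}τ₀, ε^{-3}τ₀], ‖ψ_u(t) − a(t)‖_{ℓ²(ℤ²)} ≤ C_s ε^{s−3/2} ‖A(·,·,ε³t)‖_{H^s(ℝ²)}. -/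

import Mathlib

open MeasureTheory Set

noncomputable section

/-- The torus `𝕋² = [-π, π)²` as a subset of `ℝ²`. -/
def T2 : Set (ℝ × ℝ) := Ico (-Real.pi) Real.pi ×ˢ Ico (-Real.pi) Real.pi

/-- The weighted `L²` norm `‖⟨·⟩ˢ g‖_{L²(ℝ²)}` (of a Fourier transform `g`),
i.e. the `Hˢ(ℝ²)` norm of the underlying function. -/
def wL2 (s : ℝ) (g : ℝ × ℝ → ℂ) : ℝ :=
  (∫ ξ : ℝ × ℝ, (1 + ξ.1 ^ 2 + ξ.2 ^ 2) ^ s * ‖g ξ‖ ^ 2) ^ ((1 : ℝ) / 2)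

/-- Membership in `Hˢ(ℝ²)`, expressed through the Fourier transform `g`. -/
def MemHs (s : ℝ) (g : ℝ × ℝ → ℂ) : Prop :=
  Integrable fun ξ : ℝ × ℝ => (1 + ξ.1 ^ 2 + ξ.2 ^ 2) ^ s * ‖g ξ‖ ^ 2

/-- `C⁰(I, Hˢ(ℝ²))`: membership in `Hˢ` for every time in `I`, together with continuity
in the `Hˢ` norm, expressed through the time-dependent Fourier transform `g`. -/
def ContInHsOn (s : ℝ) (I : Set ℝ) (g : ℝ × ℝ → ℝ → ℂ) : Prop :=
  (∀ T ∈ I, MemHs s fun ξ => g ξ T) ∧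
  ∀ T ∈ I, ∀ δ > (0 : ℝ), ∃ η > (0 : ℝ), ∀ T' ∈ I, |T' - T| < η →
    wL2 s (fun ξ => g ξ T' - g ξ T) < δ

/-- The `ℓ²(ℤ²)` norm of a complex sequence. -/
def l2Z (a : ℤ × ℤ → ℂ) : ℝ := (∑' p : ℤ × ℤ, ‖a p‖ ^ 2) ^ ((1 : ℝ) / 2)

/-- The band-limited modulated ansatz
`ψ̂_u(k, l, t) = ε⁻³ e^{ikt} χ_{𝕋²}(k, l) Â(k/ε, l/ε², ε³t)` in Fourier space. -/
def psiUhat (ε : ℝ) (Ahat : ℝ × ℝ → ℝ → ℂ) (k : ℝ × ℝ) (t : ℝ) : ℂ :=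
  T2.indicator (fun k' : ℝ × ℝ =>
    ((ε : ℂ))⁻¹ ^ 3 * Complex.exp (Complex.I * (k'.1 : ℂ) * (t : ℂ)) *
      Ahat (k'.1 / ε, k'.2 / ε ^ 2) (ε ^ 3 * t)) k

/-- The sequence on `ℤ²` obtained from a function on `𝕋²` by inverse Fourier series. -/
def invFourierSeq (g : ℝ × ℝ → ℂ) (p : ℤ × ℤ) : ℂ :=
  (1 / (2 * (Real.pi : ℂ))) * ∫ k in T2,
    g k * Complex.exp (-(Complex.I * ((k.1 : ℂ) * (p.1 : ℂ) + (k.2 : ℂ) * (p.2 : ℂ))))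

/-- The phase `e^{-ik·p}`. -/
def eP (p : ℤ × ℤ) (k : ℝ × ℝ) : ℂ :=
  Complex.exp (-(Complex.I * ((k.1 : ℂ) * (p.1 : ℂ) + (k.2 : ℂ) * (p.2 : ℂ))))

lemma continuous_eP (p : ℤ × ℤ) : Continuous (eP p) := by
  unfold eP; fun_prop

lemma norm_eP (p : ℤ × ℤ) (k : ℝ × ℝ) : ‖eP p k‖ = 1 := by
  have : eP p k = Complex.exp (((-(k.1 * p.1 + k.2 * p.2) : ℝ) : ℂ) * Complex.I) := by
    unfold eP; congr 1; push_cast; ring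
  rw [this, Complex.norm_exp_ofReal_mul_I]

lemma eP_periodic (p j : ℤ × ℤ) (k : ℝ × ℝ) :
    eP p (k.1 - 2 * Real.pi * j.1, k.2 - 2 * Real.pi * j.2) = eP p k := by
  unfold eP
  rw [Complex.exp_eq_exp_iff_exists_int]
  refine ⟨j.1 * p.1 + j.2 * p.2, ?_⟩
  push_cast; ring

lemma measurableSet_T2 : MeasurableSet T2 := measurableSet_Ico.prod measurableSet_Ico

lemma volume_T2_lt_top : volume T2 < ⊤ := by
  unfold T2
  rw [Measure.volume_eq_prod, Measure.prod_prod, Real.volume_Ico]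
  exact ENNReal.mul_lt_top ENNReal.ofReal_lt_top ENNReal.ofReal_lt_top

lemma integral_exp_int (n : ℤ) :
    ∫ x in Ico (-Real.pi) Real.pi, Complex.exp (-(Complex.I * ((x : ℂ) * (n : ℂ)))) =
      if n = 0 then 2 * (Real.pi : ℂ) else 0 := by
  rw [integral_Ico_eq_integral_Ioc, ← intervalIntegral.integral_of_le (by linarith [Real.pi_pos])]
  split_ifs with h
  · subst h; simp; ring
  · have hc : (-(Complex.I * n)) ≠ 0 := by simpa using h
    have := integral_exp_mul_complex (a := -Real.pi) (b := Real.pi) hc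
    rw [show (fun x : ℝ => Complex.exp (-(Complex.I * ((x : ℂ) * (n : ℂ))))) =
      fun x : ℝ => Complex.exp (-(Complex.I * n) * x) by ext x; congr 1; ring, this]
    have : Complex.exp (-(Complex.I * n) * (Real.pi : ℂ)) =
        Complex.exp (-(Complex.I * n) * ((-Real.pi : ℝ) : ℂ)) := by
      rw [Complex.exp_eq_exp_iff_exists_int]
      refine ⟨-n, ?_⟩
      push_cast; ring
    rw [this]; simp

lemma integral_eP (p : ℤ × ℤ) :
    ∫ k in T2, eP p k = if p = 0 then (2 * (Real.pi : ℂ)) ^ 2 else 0 := by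
  have h := setIntegral_prod_mul (μ := (volume : Measure ℝ)) (ν := (volume : Measure ℝ))
    (fun x : ℝ => Complex.exp (-(Complex.I * ((x : ℂ) * (p.1 : ℂ)))))
    (fun x : ℝ => Complex.exp (-(Complex.I * ((x : ℂ) * (p.2 : ℂ)))))
    (Ico (-Real.pi) Real.pi) (Ico (-Real.pi) Real.pi)
  rw [integral_exp_int, integral_exp_int] at h
  have h2 : ∫ k in T2, eP p k = (if p.1 = 0 then 2 * (Real.pi : ℂ) else 0) *
      (if p.2 = 0 then 2 * (Real.pi : ℂ) else 0) := by
    refine Eq.trans ?_ h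
    rw [Measure.volume_eq_prod]
    unfold T2
    congr 1
    ext k
    unfold eP
    rw [← Complex.exp_add]; congr 1; ring
  rw [h2]
  by_cases h1 : p.1 = 0 <;> by_cases h2 : p.2 = 0 <;> simp [h1, h2, Prod.ext_iff, sq]

lemma eP_mul_conj (p q : ℤ × ℤ) (k : ℝ × ℝ) :
    eP p k * (starRingEnd ℂ) (eP q k) = eP (p - q) k := by
  unfold eP
  rw [← Complex.exp_conj, ← Complex.exp_add]
  congr 1
  simp
  ring

lemma integrableOn_T2 {E : Type*} [NormedAddCommGroup E] {f : ℝ × ℝ → E} (hf : Continuous f) :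
    IntegrableOn f T2 := by
  refine (hf.continuousOn.integrableOn_compact
    (isCompact_Icc.prod isCompact_Icc : IsCompact
      (Icc (-Real.pi) Real.pi ×ˢ Icc (-Real.pi) Real.pi))).mono_set ?_
  exact Set.prod_mono Ico_subset_Icc_self Ico_subset_Icc_self

/-- Parseval for trigonometric polynomials. -/
lemma parseval (F : Finset (ℤ × ℤ)) (d : ℤ × ℤ → ℂ) :
    ∫ k in T2, ‖∑ p ∈ F, d p * eP p k‖ ^ 2 = (2 * Real.pi) ^ 2 * ∑ p ∈ F, ‖d p‖ ^ 2 := by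
  have h : ∀ k, ((‖∑ p ∈ F, d p * eP p k‖ ^ 2 : ℝ) : ℂ) =
      ∑ p ∈ F, ∑ q ∈ F, d p * (starRingEnd ℂ) (d q) * eP (p - q) k := by
    intro k
    rw [Complex.ofReal_pow, ← Complex.mul_conj', map_sum, Finset.sum_mul_sum]
    refine Finset.sum_congr rfl fun p _ => Finset.sum_congr rfl fun q _ => ?_
    rw [← eP_mul_conj, map_mul]; ring
  have hi : ∀ p q : ℤ × ℤ, IntegrableOn
      (fun k => d p * (starRingEnd ℂ) (d q) * eP (p - q) k) T2 := fun p q =>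
    integrableOn_T2 (continuous_const.mul (continuous_eP _))
  apply Complex.ofReal_injective
  rw [← integral_complex_ofReal]
  simp_rw [h]
  rw [integral_finsetSum _ fun p _ => integrable_finsetSum _ fun q _ => hi p q]
  push_cast
  rw [Finset.mul_sum]
  refine Finset.sum_congr rfl fun p hp => ?_
  rw [integral_finsetSum _ fun q _ => hi p q]
  simp_rw [integral_const_mul, integral_eP, sub_eq_zero]
  rw [Finset.sum_eq_single p]
  · rw [if_pos rfl, Complex.mul_conj']; ring
  · intro q _ hq; rw [if_neg (Ne.symm hq), mul_zero]
  · intro h; exact absurd hp h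

/-- Covering argument on the complement of the fundamental cell. -/
lemma cover_bound (v q : ℝ × ℝ → ENNReal) (c : ℤ × ℤ → ENNReal)
    (hq : ∀ (j : ℤ × ℤ) k, q (k.1 - 2 * Real.pi * j.1, k.2 - 2 * Real.pi * j.2) = q k)
    (hqm : Measurable q)
    (hv : ∀ (j : ℤ × ℤ) (k : ℝ × ℝ), j ≠ 0 →
      (k.1 - 2 * Real.pi * j.1, k.2 - 2 * Real.pi * j.2) ∈ T2 → v k ≤ c j) :
    ∫⁻ k in T2ᶜ, v k * q k ≤ (∑' j, c j) * ∫⁻ k in T2, q k := by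
  have hpi := Real.pi_pos
  let sh : ℤ × ℤ → ℝ × ℝ → ℝ × ℝ := fun j k => k - (2 * Real.pi * j.1, 2 * Real.pi * j.2)
  have hsh : ∀ j k, sh j k = (k.1 - 2 * Real.pi * j.1, k.2 - 2 * Real.pi * j.2) := fun j k => rfl
  have hsub : T2ᶜ ⊆ ⋃ j : ℤ × ℤ, (T2ᶜ ∩ sh j ⁻¹' T2) := by
    intro k hk
    have key : ∀ x : ℝ, x - 2 * Real.pi * ⌊(x + Real.pi) / (2 * Real.pi)⌋ ∈
        Ico (-Real.pi) Real.pi := by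
      intro x
      have h1 := Int.floor_le ((x + Real.pi) / (2 * Real.pi))
      have h2 := Int.lt_floor_add_one ((x + Real.pi) / (2 * Real.pi))
      rw [le_div_iff₀ (by positivity)] at h1
      rw [div_lt_iff₀ (by positivity)] at h2
      constructor <;> linarith
    refine mem_iUnion.2 ⟨(⌊(k.1 + Real.pi) / (2 * Real.pi)⌋, ⌊(k.2 + Real.pi) / (2 * Real.pi)⌋),
      hk, ?_⟩
    exact ⟨key k.1, key k.2⟩
  calc ∫⁻ k in T2ᶜ, v k * q k
      ≤ ∫⁻ k in ⋃ j : ℤ × ℤ, (T2ᶜ ∩ sh j ⁻¹' T2), v k * q k := lintegral_mono_set hsub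
    _ ≤ ∑' j, ∫⁻ k in T2ᶜ ∩ sh j ⁻¹' T2, v k * q k := lintegral_iUnion_le _ _
    _ ≤ ∑' j, c j * ∫⁻ k in T2, q k := by
        refine ENNReal.tsum_le_tsum fun j => ?_
        by_cases hj : j = 0
        · have : T2ᶜ ∩ sh j ⁻¹' T2 = ∅ := by
            ext k
            have : k - ((0 : ℝ), (0 : ℝ)) = k := sub_zero k
            simp [hj, sh, this]
          rw [this]; simp
        have hmp : MeasurePreserving (sh j) volume volume :=
          measurePreserving_sub_right volume _
        have hemb : MeasurableEmbedding (sh j) := measurableEmbedding_subRight _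
        calc ∫⁻ k in T2ᶜ ∩ sh j ⁻¹' T2, v k * q k
            ≤ ∫⁻ k in sh j ⁻¹' T2, v k * q k := lintegral_mono_set inter_subset_right
          _ ≤ ∫⁻ k in sh j ⁻¹' T2, c j * q k := by
              refine setLIntegral_mono (measurable_const.mul hqm) fun k hk => ?_
              gcongr
              exact hv j k hj hk
          _ = c j * ∫⁻ k in sh j ⁻¹' T2, q (sh j k) := by
              rw [lintegral_const_mul _ hqm]
              simp_rw [hsh, hq]
          _ = c j * ∫⁻ k in T2, q k := by
              rw [hmp.setLIntegral_comp_preimage_emb hemb]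
    _ = _ := ENNReal.tsum_mul_right

lemma summable_norm_int2 {s : ℝ} (hs : 1 < s) :
    Summable fun j : ℤ × ℤ => ‖j‖ ^ (-(2 * s)) := by
  have h := EisensteinSeries.summable_one_div_norm_rpow (k := 2 * s) (by linarith)
  rw [← (finTwoArrowEquiv _).symm.summable_iff] at h
  refine h.congr fun j => ?_
  simp only [Function.comp]
  congr 1
  rw [Prod.norm_def]
  simp [EisensteinSeries.norm_eq_max_natAbs, Int.norm_eq_abs]

/-- The rescaled weight. -/
def wt (s ε : ℝ) (k : ℝ × ℝ) : ℝ := (1 + (k.1 / ε) ^ 2 + (k.2 / ε ^ 2) ^ 2) ^ s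

lemma wt_pos (s ε : ℝ) (k : ℝ × ℝ) : 0 < wt s ε k := by unfold wt; positivity

lemma measurable_wt (s ε : ℝ) : Measurable (wt s ε) := by unfold wt; fun_prop

lemma wt_inv_le {s ε : ℝ} (hs : 1 < s) (hε : ε ∈ Ioc (0 : ℝ) 1) (j : ℤ × ℤ) (k : ℝ × ℝ)
    (hj : j ≠ 0) (hk : (k.1 - 2 * Real.pi * j.1, k.2 - 2 * Real.pi * j.2) ∈ T2) :
    (wt s ε k)⁻¹ ≤ ε ^ (2 * s) * ‖j‖ ^ (-(2 * s)) := by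
  have hε0 := hε.1
  have hjn : 0 < ‖j‖ := norm_pos_iff.2 hj
  have key : ∀ (x : ℝ) (n : ℤ), x - 2 * Real.pi * n ∈ Ico (-Real.pi) Real.pi →
      (n : ℝ) ^ 2 ≤ x ^ 2 := by
    intro x n hx
    have h3 := Real.pi_gt_three
    obtain ⟨h1, h2⟩ := hx
    rcases lt_trichotomy n 0 with h | h | h
    · have : (n : ℝ) ≤ -1 := by exact_mod_cast (by omega : n ≤ -1)
      have : x ≤ n := by nlinarith
      nlinarith
    · subst h; simp; positivity
    · have : (1 : ℝ) ≤ n := by exact_mod_cast h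
      have : (n : ℝ) ≤ x := by nlinarith
      nlinarith
  have h1 := key _ _ hk.1
  have h2 := key _ _ hk.2
  have hb : (‖j‖ / ε) ^ 2 ≤ 1 + (k.1 / ε) ^ 2 + (k.2 / ε ^ 2) ^ 2 := by
    have e1 : (k.2 / ε) ^ 2 ≤ (k.2 / ε ^ 2) ^ 2 := by
      rw [div_pow, div_pow]
      gcongr (k.2 ^ 2 / ?_)
      have := hε.2
      have h4 : ε ^ 2 ≤ 1 * ε := by nlinarith
      nlinarith [sq_nonneg ε]
    have e2 : ‖j‖ ^ 2 ≤ k.1 ^ 2 + k.2 ^ 2 := by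
      rw [Prod.norm_def]
      rcases max_choice ‖j.1‖ ‖j.2‖ with h | h <;> rw [h] <;>
        simp only [Int.norm_eq_abs, sq_abs] <;> nlinarith [sq_nonneg k.1, sq_nonneg k.2]
    have e3 : (‖j‖ / ε) ^ 2 ≤ (k.1 / ε) ^ 2 + (k.2 / ε) ^ 2 := by
      simp only [div_pow, ← add_div]; gcongr
    linarith
  have hpos : 0 < ‖j‖ / ε := by positivity
  have hw : ((‖j‖ / ε) ^ 2) ^ s ≤ wt s ε k := Real.rpow_le_rpow (by positivity) hb (by linarith)
  refine (inv_anti₀ (by positivity) hw).trans (le_of_eq ?_)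
  rw [← Real.rpow_natCast, ← Real.rpow_mul hpos.le, Nat.cast_ofNat,
    Real.div_rpow hjn.le hε0.le, Real.rpow_neg hjn.le, inv_div, div_eq_mul_inv]

/-- The lattice constant. -/
def Kc (s : ℝ) : ℝ := ∑' j : ℤ × ℤ, ‖j‖ ^ (-(2 * s)) + 1

lemma Kc_pos (s : ℝ) : 0 < Kc s := by
  have : 0 ≤ ∑' j : ℤ × ℤ, ‖j‖ ^ (-(2 * s)) := tsum_nonneg fun j => by positivity
  unfold Kc; linarith

lemma weight_bound {s ε : ℝ} (hs : 1 < s) (hε : ε ∈ Ioc (0 : ℝ) 1) (F : Finset (ℤ × ℤ))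
    (d : ℤ × ℤ → ℂ) :
    IntegrableOn (fun k => (wt s ε k)⁻¹ * ‖∑ p ∈ F, d p * eP p k‖ ^ 2) T2ᶜ ∧
    ∫ k in T2ᶜ, (wt s ε k)⁻¹ * ‖∑ p ∈ F, d p * eP p k‖ ^ 2 ≤
      (Kc s * ε ^ (2 * s)) * ((2 * Real.pi) ^ 2 * ∑ p ∈ F, ‖d p‖ ^ 2) := by
  have hε0 := hε.1
  set Q : ℝ × ℝ → ℂ := fun k => ∑ p ∈ F, d p * eP p k with hQ
  have hQc : Continuous Q :=
    continuous_finsetSum _ fun p _ => continuous_const.mul (continuous_eP p)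
  have hcb := cover_bound (fun k => ENNReal.ofReal (wt s ε k)⁻¹)
    (fun k => ENNReal.ofReal (‖Q k‖ ^ 2))
    (fun j => ENNReal.ofReal (ε ^ (2 * s) * ‖j‖ ^ (-(2 * s))))
    (fun j k => by simp only [hQ, eP_periodic])
    (by have := hQc.measurable; fun_prop)
    (fun j k hj hk => ENNReal.ofReal_le_ofReal (wt_inv_le hs hε j k hj hk))
  have hmeas : Measurable fun k => (wt s ε k)⁻¹ * ‖Q k‖ ^ 2 := by
    have := hQc.measurable
    have := measurable_wt s ε
    fun_prop
  have hsum := (summable_norm_int2 hs).mul_left (ε ^ (2 * s))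
  have hpos : ∀ k, 0 ≤ (wt s ε k)⁻¹ * ‖Q k‖ ^ 2 := fun k =>
    mul_nonneg (inv_nonneg.2 (wt_pos s ε k).le) (by positivity)
  have hle : ∫⁻ k in T2ᶜ, ENNReal.ofReal ((wt s ε k)⁻¹ * ‖Q k‖ ^ 2) ≤
      ENNReal.ofReal ((Kc s * ε ^ (2 * s)) * ((2 * Real.pi) ^ 2 * ∑ p ∈ F, ‖d p‖ ^ 2)) := by
    simp_rw [ENNReal.ofReal_mul (inv_nonneg.2 (wt_pos s ε _).le)]
    refine hcb.trans ?_
    rw [← ENNReal.ofReal_tsum_of_nonneg (fun j => by positivity) hsum,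
      ← ofReal_integral_eq_lintegral_ofReal (integrableOn_T2 (by fun_prop))
        (Filter.Eventually.of_forall fun k => by positivity), parseval,
      ← ENNReal.ofReal_mul (tsum_nonneg fun j => by positivity), tsum_mul_left]
    apply ENNReal.ofReal_le_ofReal
    refine mul_le_mul_of_nonneg_right ?_ (by positivity)
    rw [mul_comm]
    refine mul_le_mul_of_nonneg_right ?_ (by positivity)
    unfold Kc; linarith
  have hint : IntegrableOn (fun k => (wt s ε k)⁻¹ * ‖Q k‖ ^ 2) T2ᶜ := by
    refine ⟨hmeas.aestronglyMeasurable, ?_⟩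
    rw [hasFiniteIntegral_iff_ofReal (Filter.Eventually.of_forall hpos)]
    exact hle.trans_lt ENNReal.ofReal_lt_top
  refine ⟨hint, ?_⟩
  have hK := Kc_pos s
  rw [← ENNReal.ofReal_le_ofReal_iff (by positivity),
    ofReal_integral_eq_lintegral_ofReal hint (Filter.Eventually.of_forall hpos)]
  exact hle

lemma core {s ε : ℝ} (hs : 1 < s) (hε : ε ∈ Ioc (0 : ℝ) 1) (G : ℝ × ℝ → ℂ) (hG : Integrable G)
    (hM : Integrable fun k => wt s ε k * ‖G k‖ ^ 2) (F : Finset (ℤ × ℤ)) (d : ℤ × ℤ → ℂ)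
    (hd : ∀ p, d p = (1 / (2 * (Real.pi : ℂ))) * ∫ k in T2ᶜ, G k * eP p k) :
    ∑ p ∈ F, ‖d p‖ ^ 2 ≤ Kc s * ε ^ (2 * s) * ∫ k, wt s ε k * ‖G k‖ ^ 2 := by
  have hε0 := hε.1
  have hpi := Real.pi_pos
  have hK := Kc_pos s
  obtain ⟨hwi, hw⟩ := weight_bound hs hε F (fun p => (starRingEnd ℂ) (d p))
  simp only [RCLike.norm_conj] at hw
  set Q : ℝ × ℝ → ℂ := fun k => ∑ p ∈ F, (starRingEnd ℂ) (d p) * eP p k with hQ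
  set S := ∑ p ∈ F, ‖d p‖ ^ 2 with hS
  set M := ∫ k, wt s ε k * ‖G k‖ ^ 2 with hMdef
  set c := Kc s * ε ^ (2 * s) with hc
  have hc0 : 0 < c := by positivity
  have hGi : ∀ p, IntegrableOn (fun k => G k * eP p k) T2ᶜ := fun p =>
    (hG.mul_bdd (c := 1) (continuous_eP p).aestronglyMeasurable
      (Filter.Eventually.of_forall fun k => (norm_eP p k).le)).integrableOn
  have h1 : ((2 * Real.pi * S : ℝ) : ℂ) = ∫ k in T2ᶜ, G k * Q k := by
    have e : ∀ k, G k * Q k = ∑ p ∈ F, (starRingEnd ℂ) (d p) * (G k * eP p k) := by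
      intro k; rw [hQ, Finset.mul_sum]; refine Finset.sum_congr rfl fun p _ => by ring
    simp_rw [e]
    rw [integral_finsetSum _ fun p _ => (hGi p).const_mul _]
    simp_rw [integral_const_mul]
    rw [hS]; push_cast; rw [Finset.mul_sum]
    refine Finset.sum_congr rfl fun p _ => ?_
    have e2 : ∫ k in T2ᶜ, G k * eP p k = 2 * Real.pi * d p := by
      rw [hd p]
      have : (Real.pi : ℂ) ≠ 0 := by exact_mod_cast hpi.ne'
      field_simp
    rw [e2, ← Complex.conj_mul']; ring
  have hS0 : 0 ≤ S := Finset.sum_nonneg fun p _ => by positivity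
  have h2 : 2 * Real.pi * S ≤ ∫ k in T2ᶜ, ‖G k * Q k‖ := by
    have := norm_integral_le_integral_norm (μ := volume.restrict T2ᶜ) (fun k => G k * Q k)
    rw [← h1, Complex.norm_real, Real.norm_of_nonneg (by positivity)] at this
    exact this
  have h3 : ∫ k in T2ᶜ, ‖G k * Q k‖ ≤ ∫ k in T2ᶜ,
      ((Real.pi * c) * (wt s ε k * ‖G k‖ ^ 2) + (4 * Real.pi * c)⁻¹ * ((wt s ε k)⁻¹ * ‖Q k‖ ^ 2)) := by
    refine integral_mono_of_nonneg (Filter.Eventually.of_forall fun k => norm_nonneg _)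
      ((hM.integrableOn.const_mul _).add (hwi.const_mul _))
      (Filter.Eventually.of_forall fun k => ?_)
    have hwp := wt_pos s ε k
    simp only [norm_mul]
    have : Real.pi * c * (wt s ε k * ‖G k‖ ^ 2) + (4 * Real.pi * c)⁻¹ * ((wt s ε k)⁻¹ * ‖Q k‖ ^ 2)
        - ‖G k‖ * ‖Q k‖ = (2 * Real.pi * c * wt s ε k * ‖G k‖ - ‖Q k‖) ^ 2 /
          (4 * Real.pi * c * wt s ε k) := by
      field_simp; ring
    have h0 : 0 ≤ (2 * Real.pi * c * wt s ε k * ‖G k‖ - ‖Q k‖) ^ 2 /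
          (4 * Real.pi * c * wt s ε k) := by positivity
    linarith
  rw [integral_add (hM.integrableOn.const_mul _) (hwi.const_mul _), integral_const_mul,
    integral_const_mul] at h3
  have h4 : ∫ k in T2ᶜ, wt s ε k * ‖G k‖ ^ 2 ≤ M :=
    setIntegral_le_integral hM (Filter.Eventually.of_forall fun k =>
      mul_nonneg (wt_pos s ε k).le (by positivity))
  have h5 : (4 * Real.pi * c)⁻¹ * ∫ k in T2ᶜ, ((wt s ε k)⁻¹ * ‖Q k‖ ^ 2) ≤ Real.pi * S := by
    calc _ ≤ (4 * Real.pi * c)⁻¹ * (c * ((2 * Real.pi) ^ 2 * S)) := by gcongr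
      _ = Real.pi * S := by field_simp; ring
  have h6 : Real.pi * c * ∫ k in T2ᶜ, wt s ε k * ‖G k‖ ^ 2 ≤ Real.pi * c * M := by gcongr
  have h7 : Real.pi * S ≤ Real.pi * (c * M) := by linarith
  exact le_of_mul_le_mul_left h7 hpi

/-- The anisotropic scaling. -/
def scl (ε : ℝ) (k : ℝ × ℝ) : ℝ × ℝ := (k.1 / ε, k.2 / ε ^ 2)

lemma scl_emb {ε : ℝ} (hε : 0 < ε) : MeasurableEmbedding (scl ε) :=
  ((Homeomorph.mulRight₀ (ε⁻¹) (by positivity)).prodCongr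
    (Homeomorph.mulRight₀ ((ε ^ 2)⁻¹) (by positivity))).measurableEmbedding

lemma scl_map {ε : ℝ} (hε : 0 < ε) :
    Measure.map (scl ε) volume = ENNReal.ofReal (ε ^ 3) • (volume : Measure (ℝ × ℝ)) := by
  have e : scl ε = Prod.map (fun x : ℝ => x * ε⁻¹) (fun x : ℝ => x * (ε ^ 2)⁻¹) := rfl
  rw [e, Measure.volume_eq_prod, ← Measure.map_prod_map _ _ (by fun_prop) (by fun_prop),
    Real.map_volume_mul_right (by positivity), Real.map_volume_mul_right (by positivity),
    Measure.prod_smul_left, Measure.prod_smul_right, smul_smul, inv_inv, inv_inv,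
    abs_of_pos hε, abs_of_pos (by positivity), ← ENNReal.ofReal_mul (by positivity)]
  congr 2; ring

lemma scl_integral {E : Type*} [NormedAddCommGroup E] [NormedSpace ℝ E] {ε : ℝ} (hε : 0 < ε)
    (f : ℝ × ℝ → E) : ∫ k, f (scl ε k) = ε ^ 3 • ∫ ξ, f ξ := by
  rw [← (scl_emb hε).integral_map, scl_map hε, integral_smul_measure,
    ENNReal.toReal_ofReal (by positivity)]

lemma scl_integrable {E : Type*} [NormedAddCommGroup E] {ε : ℝ} (hε : 0 < ε)
    {f : ℝ × ℝ → E} (hf : Integrable f) : Integrable fun k => f (scl ε k) := by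
  have := hf.smul_measure (c := ENNReal.ofReal (ε ^ 3)) ENNReal.ofReal_ne_top
  rw [← scl_map hε, (scl_emb hε).integrable_map_iff] at this
  exact this

/-- The full-space rescaled modulated transform. -/
def Gf (ε t : ℝ) (g : ℝ × ℝ → ℂ) (k : ℝ × ℝ) : ℂ :=
  ((ε : ℂ))⁻¹ ^ 3 * Complex.exp (Complex.I * (k.1 : ℂ) * (t : ℂ)) * g (scl ε k)

lemma norm_Gf {ε : ℝ} (hε : 0 < ε) (t : ℝ) (g : ℝ × ℝ → ℂ) (k : ℝ × ℝ) :
    ‖Gf ε t g k‖ = (ε⁻¹) ^ 3 * ‖g (scl ε k)‖ := by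
  have : Complex.exp (Complex.I * (k.1 : ℂ) * (t : ℂ)) =
      Complex.exp (((k.1 * t : ℝ) : ℂ) * Complex.I) := by congr 1; push_cast; ring
  unfold Gf
  rw [this, norm_mul, norm_mul, Complex.norm_exp_ofReal_mul_I, mul_one, norm_pow, norm_inv,
    Complex.norm_real, Real.norm_of_nonneg hε.le]

lemma Gf_integrable {ε : ℝ} (hε : 0 < ε) (t : ℝ) {g : ℝ × ℝ → ℂ} (hg : Integrable g) :
    Integrable (Gf ε t g) := by
  have h := scl_integrable hε hg
  refine Integrable.mono (h.const_mul (((ε : ℂ))⁻¹ ^ 3)) ?_ ?_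
  · unfold Gf
    exact AEStronglyMeasurable.mul (Continuous.aestronglyMeasurable (by fun_prop)) h.1
  · refine Filter.Eventually.of_forall fun k => ?_
    rw [norm_Gf hε, norm_mul, norm_pow, norm_inv, Complex.norm_real, Real.norm_of_nonneg hε.le]

lemma Gf_weight {s ε : ℝ} (hε : 0 < ε) (t : ℝ) {g : ℝ × ℝ → ℂ} (hg : MemHs s g) :
    Integrable (fun k => wt s ε k * ‖Gf ε t g k‖ ^ 2) ∧
    ∫ k, wt s ε k * ‖Gf ε t g k‖ ^ 2 =
      (ε⁻¹) ^ 3 * ∫ ξ : ℝ × ℝ, (1 + ξ.1 ^ 2 + ξ.2 ^ 2) ^ s * ‖g ξ‖ ^ 2 := by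
  have e : ∀ k, wt s ε k * ‖Gf ε t g k‖ ^ 2 = (ε⁻¹) ^ 6 *
      (fun ξ : ℝ × ℝ => (1 + ξ.1 ^ 2 + ξ.2 ^ 2) ^ s * ‖g ξ‖ ^ 2) (scl ε k) := by
    intro k; rw [norm_Gf hε]; simp only [wt, scl]; ring
  simp_rw [e]
  refine ⟨(scl_integrable hε hg).const_mul _, ?_⟩
  rw [integral_const_mul, scl_integral hε
    (fun ξ : ℝ × ℝ => (1 + ξ.1 ^ 2 + ξ.2 ^ 2) ^ s * ‖g ξ‖ ^ 2), smul_eq_mul, ← mul_assoc]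
  congr 1
  field_simp

/-- **Band-limited interpolation error.**
Let `s > 1` and `A ∈ C⁰([-τ₀, τ₀], Hˢ(ℝ²))`, realized as the inverse Fourier transform of
`Â`. With the sampled sequence `a_{m,n}(t) = A(ε(m - t), ε² n, ε³ t)` and the band-limited
approximation `ψ_u(t)` (the inverse Fourier series of `ψ̂_u`), one has
`‖ψ_u(t) - a(t)‖_{ℓ²(ℤ²)} ≤ C_s ε^{s - 3/2} ‖A(·,·,ε³t)‖_{Hˢ(ℝ²)}` with a constant `C_s`
depending only on `s`. -/
theorem band_limited_interpolation_error (s : ℝ) (hs : 1 < s) :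
    ∃ C > (0 : ℝ), ∀ (τ₀ : ℝ), 0 < τ₀ → ∀ (A : ℝ × ℝ → ℝ → ℂ) (Ahat : ℝ × ℝ → ℝ → ℂ),
      (∀ T ∈ Icc (-τ₀) τ₀, Integrable fun ξ : ℝ × ℝ => Ahat ξ T) →
      (∀ x : ℝ × ℝ, ∀ T ∈ Icc (-τ₀) τ₀,
        A x T = (1 / (2 * (Real.pi : ℂ))) * ∫ ξ : ℝ × ℝ, Ahat ξ T *
          Complex.exp (-(Complex.I * ((ξ.1 : ℂ) * (x.1 : ℂ) + (ξ.2 : ℂ) * (x.2 : ℂ))))) →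
      ContInHsOn s (Icc (-τ₀) τ₀) Ahat →
      ∀ ε ∈ Ioc (0 : ℝ) 1, ∀ t : ℝ, |t| ≤ τ₀ / ε ^ 3 →
        l2Z (fun p : ℤ × ℤ =>
            invFourierSeq (fun k => psiUhat ε Ahat k t) p
              - A (ε * ((p.1 : ℝ) - t), ε ^ 2 * (p.2 : ℝ)) (ε ^ 3 * t)) ≤
          C * ε ^ (s - 3 / 2) * wL2 s (fun ξ => Ahat ξ (ε ^ 3 * t)) := by
  refine ⟨(Kc s) ^ ((1 : ℝ) / 2), Real.rpow_pos_of_pos (Kc_pos s) _, ?_⟩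
  intro τ₀ hτ A Ahat hint hA hcont ε hε t ht
  have hε0 := hε.1
  have hK := Kc_pos s
  have hT : ε ^ 3 * t ∈ Icc (-τ₀) τ₀ := by
    rw [le_div_iff₀ (by positivity)] at ht
    rw [mem_Icc, ← abs_le, abs_mul, abs_of_pos (by positivity : 0 < ε ^ 3)]
    linarith
  set g : ℝ × ℝ → ℂ := fun ξ => Ahat ξ (ε ^ 3 * t) with hg
  have hgi : Integrable g := hint _ hT
  have hgs : MemHs s g := hcont.1 _ hT
  have hGi := Gf_integrable hε0 t hgi
  obtain ⟨hM, hMe⟩ := Gf_weight hε0 t hgs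
  set D : ℤ × ℤ → ℂ := fun p => invFourierSeq (fun k => psiUhat ε Ahat k t) p
    - A (ε * ((p.1 : ℝ) - t), ε ^ 2 * (p.2 : ℝ)) (ε ^ 3 * t) with hD
  have hd : ∀ p, - D p = (1 / (2 * (Real.pi : ℂ))) * ∫ k in T2ᶜ, Gf ε t g k * eP p k := by
    intro p
    have h1 : invFourierSeq (fun k => psiUhat ε Ahat k t) p =
        (1 / (2 * (Real.pi : ℂ))) * ∫ k in T2, Gf ε t g k * eP p k := by
      unfold invFourierSeq
      congr 1
      refine setIntegral_congr_fun measurableSet_T2 fun k hk => ?_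
      simp only [psiUhat, indicator_of_mem hk]
      rfl
    have h2 : A (ε * ((p.1 : ℝ) - t), ε ^ 2 * (p.2 : ℝ)) (ε ^ 3 * t) =
        (1 / (2 * (Real.pi : ℂ))) * ∫ k, Gf ε t g k * eP p k := by
      rw [hA _ _ hT]
      congr 1
      have hεc : (ε : ℂ) ≠ 0 := by exact_mod_cast hε0.ne'
      have h3 := scl_integral hε0 (fun ξ : ℝ × ℝ => ((ε : ℂ))⁻¹ ^ 3 * (Ahat ξ (ε ^ 3 * t) *
          Complex.exp (-(Complex.I * ((ξ.1 : ℂ) * ((ε * ((p.1 : ℝ) - t) : ℝ) : ℂ) +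
            (ξ.2 : ℂ) * ((ε ^ 2 * (p.2 : ℝ) : ℝ) : ℂ))))))
      conv_rhs at h3 => rw [integral_const_mul, Complex.real_smul, ← mul_assoc]
      have h4 : ((ε ^ 3 : ℝ) : ℂ) * ((ε : ℂ))⁻¹ ^ 3 = 1 := by
        push_cast; field_simp
      rw [h4, one_mul] at h3
      rw [← h3]
      refine integral_congr_ae (Filter.Eventually.of_forall fun k => ?_)
      simp only [Gf, eP, hg]
      have h5 : Complex.exp (-(Complex.I * (((scl ε k).1 : ℂ) * ((ε * ((p.1 : ℝ) - t) : ℝ) : ℂ) +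
            ((scl ε k).2 : ℂ) * ((ε ^ 2 * (p.2 : ℝ) : ℝ) : ℂ)))) =
          Complex.exp (Complex.I * (k.1 : ℂ) * (t : ℂ)) *
          Complex.exp (-(Complex.I * ((k.1 : ℂ) * (p.1 : ℂ) + (k.2 : ℂ) * (p.2 : ℂ)))) := by
        rw [← Complex.exp_add]
        congr 1
        simp only [scl]
        push_cast
        field_simp
        ring
      rw [h5]; ring
    have hGe : Integrable fun k => Gf ε t g k * eP p k :=
      hGi.mul_bdd (c := 1) (continuous_eP p).aestronglyMeasurable
        (Filter.Eventually.of_forall fun k => (norm_eP p k).le)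
    rw [hD]
    simp only
    rw [h1, h2, ← integral_add_compl measurableSet_T2 hGe]
    ring
  have hfin : ∑' p, ‖D p‖ ^ 2 ≤ Kc s * ε ^ (2 * s) * ∫ k, wt s ε k * ‖Gf ε t g k‖ ^ 2 := by
    refine Real.tsum_le_of_sum_le (fun p => by positivity) fun F => ?_
    have := core hs hε (Gf ε t g) hGi hM F (fun p => - D p) hd
    simpa only [norm_neg] using this
  rw [hMe] at hfin
  unfold l2Z wL2
  have hI : 0 ≤ ∫ ξ : ℝ × ℝ, (1 + ξ.1 ^ 2 + ξ.2 ^ 2) ^ s * ‖g ξ‖ ^ 2 :=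
    integral_nonneg fun ξ => by positivity
  refine (Real.rpow_le_rpow (tsum_nonneg fun p => by positivity) hfin (by norm_num)).trans
    (le_of_eq ?_)
  have h6 : Kc s * ε ^ (2 * s) * ((ε⁻¹) ^ 3 * ∫ ξ : ℝ × ℝ, (1 + ξ.1 ^ 2 + ξ.2 ^ 2) ^ s * ‖g ξ‖ ^ 2)
      = Kc s * ε ^ (2 * s - 3) * ∫ ξ : ℝ × ℝ, (1 + ξ.1 ^ 2 + ξ.2 ^ 2) ^ s * ‖g ξ‖ ^ 2 := by
    rw [Real.rpow_sub hε0, show ε ^ (3 : ℝ) = ε ^ 3 by exact_mod_cast Real.rpow_natCast ε 3]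
    field_simp
  rw [h6, Real.mul_rpow (by positivity) hI, Real.mul_rpow hK.le (by positivity),
    ← Real.rpow_mul hε0.le]
  congr 3
  ring
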